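/- Let m, n ∈ ℕ, n ≥ 2, and α ≥ 0. Let ‖·‖_X̄ and ‖·‖_Z be rearrangement-invariant function norms over (0,1), with associate norms ‖·‖_{X̄'} and ‖·‖_{Z'}. Then the following equality holds in [0,∞]: sup over nonnegative measurable f on (0,1) with ‖f‖_X̄ ≤ 1 of ‖ ∫_{t^{n/(n+α)}}^1 f(s) s^{−1+m/n} ds ‖_Z equals sup over measurable g on (0,1) with ‖g‖_{Z'} ≤ 1 of ‖ t^{(m+α)/n} g^{**}(t^{(n+α)/n}) ‖_{X̄'}, where g^{**}(t) = (1/t)∫_0^t g^*(s) ds. -/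

import Mathlib

open MeasureTheory Set Filter Topology
open scoped ENNReal NNReal

noncomputable section

/-- The nonincreasing rearrangement of an `ℝ≥0∞`-valued function with respect to `μ`:
`f^*(t) = inf {λ : μ({f > λ}) ≤ t}`. -/
def rearr {α : Type*} [MeasurableSpace α] (μ : Measure α) (f : α → ℝ≥0∞) (t : ℝ) : ℝ≥0∞ :=
  sInf {l : ℝ≥0∞ | μ {x | l < f x} ≤ ENNReal.ofReal t}

/-- A rearrangement-invariant function norm over the measure space `(α, μ)`, acting on
nonnegative (`ℝ≥0∞`-valued) measurable functions. -/
structure RINorm {α : Type*} [MeasurableSpace α] (μ : Measure α) where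
  N : (α → ℝ≥0∞) → ℝ≥0∞
  add_le : ∀ f g : α → ℝ≥0∞, Measurable f → Measurable g →
    N (fun x => f x + g x) ≤ N f + N g
  smul_eq : ∀ (c : ℝ≥0) (f : α → ℝ≥0∞), Measurable f →
    N (fun x => (c : ℝ≥0∞) * f x) = (c : ℝ≥0∞) * N f
  eq_zero_iff : ∀ f : α → ℝ≥0∞, Measurable f → (N f = 0 ↔ f =ᵐ[μ] 0)
  mono : ∀ f g : α → ℝ≥0∞, Measurable f → Measurable g →
    (∀ᵐ x ∂μ, f x ≤ g x) → N f ≤ N g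
  fatou : ∀ (F : ℕ → α → ℝ≥0∞) (f : α → ℝ≥0∞), (∀ k, Measurable (F k)) → Measurable f →
    (∀ᵐ x ∂μ, Monotone fun k => F k x) → (∀ᵐ x ∂μ, (⨆ k, F k x) = f x) →
    (⨆ k, N (F k)) = N f
  indicator_lt_top : ∀ E : Set α, MeasurableSet E → μ E < ∞ →
    N (E.indicator fun _ => 1) < ∞
  exists_integral_le : ∀ E : Set α, MeasurableSet E → μ E < ∞ → ∃ C : ℝ≥0∞, C < ∞ ∧
    ∀ f : α → ℝ≥0∞, Measurable f → (∫⁻ x in E, f x ∂μ) ≤ C * N f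
  rearr_invariant : ∀ f g : α → ℝ≥0∞, Measurable f → Measurable g →
    (∀ l : ℝ≥0∞, μ {x | l < f x} = μ {x | l < g x}) → N f = N g


/-- Lebesgue measure on `(0,1)`. -/
def μU : Measure ℝ := volume.restrict (Set.Ioo (0 : ℝ) 1)

/-- The associate norm of an r.i. norm over `(0,1)`:
`‖g‖_{Z'} = sup { ∫_0^1 f g : ‖f‖_Z ≤ 1 }`. -/
def assocN (Z : RINorm μU) (g : ℝ → ℝ≥0∞) : ℝ≥0∞ :=
  ⨆ (f : ℝ → ℝ≥0∞) (_ : Measurable f) (_ : Z.N f ≤ 1),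
    ∫⁻ t in Set.Ioo (0 : ℝ) 1, f t * g t

instance instFiniteμU : IsFiniteMeasure μU := by
  unfold μU; infer_instance

lemma lt_rearr_iff (g : ℝ → ℝ≥0∞) (l : ℝ≥0∞) (t : ℝ) :
    l < rearr μU g t ↔ ENNReal.ofReal t < μU {x | l < g x} := by
  have hatt : μU {x | rearr μU g t < g x} ≤ ENNReal.ofReal t := by
    have hne : ({l : ℝ≥0∞ | μU {x | l < g x} ≤ ENNReal.ofReal t}).Nonempty := ⟨⊤, by simp⟩
    obtain ⟨u, hu, hut, huS⟩ := exists_seq_tendsto_sInf hne (OrderBot.bddBelow _)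
    have : {x | rearr μU g t < g x} = ⋃ n, {x | u n < g x} := by
      ext x
      simp only [mem_ofPred_eq, mem_iUnion]
      constructor
      · intro h
        exact (hut.eventually_lt_const h).exists
      · rintro ⟨n, hn⟩
        exact lt_of_le_of_lt (sInf_le (huS n)) hn
    rw [this, Monotone.measure_iUnion]
    · exact iSup_le huS
    · intro i j hij x hx
      exact lt_of_le_of_lt (hu hij) hx
  constructor
  · intro h
    by_contra! h2
    exact absurd (sInf_le (a := l) h2) (not_le.2 h)
  · intro h
    by_contra! h2
    exact absurd h (not_lt.2 (le_trans (measure_mono fun x hx => lt_of_le_of_lt h2 hx) hatt))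

lemma rearr_antitone (g : ℝ → ℝ≥0∞) : Antitone (rearr μU g) := by
  intro s t hst
  by_contra! h
  have h1 := (lt_rearr_iff g (rearr μU g s) t).1 h
  exact absurd ((lt_rearr_iff g _ s).2 (lt_of_le_of_lt (ENNReal.ofReal_le_ofReal hst) h1)) (lt_irrefl _)

lemma μU_le_one (s : Set ℝ) : μU s ≤ 1 := by
  refine (measure_mono (subset_univ s)).trans ?_
  simp [μU]

lemma μU_Iio {t : ℝ} (h0 : 0 ≤ t) (h1 : t ≤ 1) : μU (Iio t) = ENNReal.ofReal t := by
  rw [μU, Measure.restrict_apply measurableSet_Iio]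
  have : Iio t ∩ Ioo 0 1 = Ioo 0 t := by
    ext x; simp only [mem_inter_iff, mem_Iio, mem_Ioo]; constructor
    · rintro ⟨a, b, c⟩; exact ⟨b, a⟩
    · rintro ⟨a, b⟩; exact ⟨b, a, by linarith⟩
  rw [this]; simp

lemma rearr_equi (g : ℝ → ℝ≥0∞) (l : ℝ≥0∞) :
    μU {t | l < rearr μU g t} = μU {x | l < g x} := by
  have hfin : μU {x | l < g x} ≠ ⊤ := measure_ne_top _ _
  have e : {t | l < rearr μU g t} ∩ Ioi 0 = Iio (μU {x | l < g x}).toReal ∩ Ioi 0 := by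
    ext t
    simp only [mem_inter_iff, mem_ofPred_eq, lt_rearr_iff, mem_Iio, mem_Ioi]
    refine and_congr_left fun h => ?_
    rw [ENNReal.ofReal_lt_iff_lt_toReal h.le hfin]
  have hae : ∀ s : Set ℝ, μU s = μU (s ∩ Ioi 0) := by
    intro s
    unfold μU
    apply measure_congr
    filter_upwards [ae_restrict_mem measurableSet_Ioo] with x hx
    apply propext
    exact ⟨fun h => ⟨h, hx.1⟩, fun h => h.1⟩
  rw [hae, e, ← hae, μU_Iio ENNReal.toReal_nonneg, ENNReal.ofReal_toReal hfin]
  exact ENNReal.toReal_le_of_le_ofReal zero_le_one (by simpa using μU_le_one _)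

lemma exists_c (g : ℝ → ℝ≥0∞) (hg : Measurable g) (a : ℝ) (ha : a ∈ Ioo (0:ℝ) 1) :
    ∃ c : ℝ, μU ({x | rearr μU g a < g x} ∪ ({x | g x = rearr μU g a} ∩ Iio c))
      = ENNReal.ofReal a := by
  set r := rearr μU g a with hr
  set S : ℝ → Set ℝ := fun c => {x | r < g x} ∪ ({x | g x = r} ∩ Iio c) with hS
  have hL : LipschitzWith 1 (fun c => μU.real (S c)) := by
    apply LipschitzWith.of_le_add
    intro c c'
    have hsub : S c ⊆ S c' ∪ Ico c' c := by
      rintro x (hx | hx)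
      · exact Or.inl (Or.inl hx)
      · by_cases h : x < c'
        · exact Or.inl (Or.inr ⟨hx.1, h⟩)
        · exact Or.inr ⟨not_lt.1 h, hx.2⟩
    refine (measureReal_mono hsub).trans ((measureReal_union_le _ _).trans ?_)
    gcongr
    have h1 : μU (Ico c' c) ≤ ENNReal.ofReal (dist c c') := by
      refine (Measure.restrict_apply_le _ _).trans ?_
      rw [Real.volume_Ico]
      exact ENNReal.ofReal_le_ofReal (le_abs_self _)
    exact ENNReal.toReal_le_of_le_ofReal dist_nonneg h1
  have h0 : μU.real (S 0) ≤ a := by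
    have : μU (S 0) ≤ ENNReal.ofReal a := by
      have h1 : μU {x | r < g x} ≤ ENNReal.ofReal a := by
        by_contra! h
        exact lt_irrefl _ ((lt_rearr_iff g r a).2 h)
      have h2 : μU ({x | g x = r} ∩ Iio 0) ≤ 0 := by
        refine (measure_mono inter_subset_right).trans ?_
        rw [μU_Iio le_rfl zero_le_one]; simp
      exact (measure_union_le _ _).trans (by simpa using add_le_add h1 h2)
    exact ENNReal.toReal_le_of_le_ofReal ha.1.le this
  have h1 : a ≤ μU.real (S 1) := by
    have : ENNReal.ofReal a ≤ μU (S 1) := by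
      have e1 : μU (S 1) = μU {x | r ≤ g x} := by
        unfold μU
        apply measure_congr
        filter_upwards [ae_restrict_mem measurableSet_Ioo] with x hx
        apply propext
        change (r < g x ∨ (g x = r ∧ x < 1)) ↔ r ≤ g x
        rw [le_iff_lt_or_eq]
        simp [hx.2, eq_comm]
      rw [e1]
      rcases eq_or_ne r 0 with hr0 | hr0
      · rw [hr0]
        simp only [zero_le, ofPred_true]
        simp only [μU, Measure.restrict_apply_univ, Real.volume_Ioo]
        exact ENNReal.ofReal_le_ofReal (by linarith [ha.2])
      · obtain ⟨u, hu, hul, hut⟩ := exists_seq_strictMono_tendsto' (pos_iff_ne_zero.2 hr0)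
        have hI : {x | r ≤ g x} = ⋂ n, {x | u n < g x} := by
          ext x
          simp only [mem_ofPred_eq, mem_iInter]
          constructor
          · intro h n; exact lt_of_lt_of_le (hul n).2 h
          · intro h; exact le_of_tendsto' hut fun n => (h n).le
        rw [hI]
        refine ge_of_tendsto' (tendsto_measure_iInter_atTop (μ := μU)
          (s := fun n => {x | u n < g x}) ?_ ?_ ?_) ?_
        · intro n; exact (measurableSet_lt measurable_const hg).nullMeasurableSet
        · intro i j hij x hx; exact lt_of_le_of_lt (hu.monotone hij) hx
        · exact ⟨0, measure_ne_top _ _⟩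
        · intro n
          exact ((lt_rearr_iff g (u n) a).1 (hul n).2).le
    rw [measureReal_def]
    exact (ENNReal.ofReal_le_iff_le_toReal (measure_ne_top _ _)).1 this
  obtain ⟨c, -, hc⟩ := intermediate_value_Icc zero_le_one hL.continuous.continuousOn ⟨h0, h1⟩
  refine ⟨c, ?_⟩
  simp only [measureReal_def] at hc
  rw [← hc, ENNReal.ofReal_toReal (measure_ne_top _ _)]

lemma exists_sigma (g : ℝ → ℝ≥0∞) (hg : Measurable g) :
    ∃ σ : ℝ → ℝ, MeasurePreserving σ μU μU ∧ ∀ᵐ x ∂μU, rearr μU g (σ x) ≤ g x := by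
  have hex : ∀ a : ℝ, ∃ c : ℝ, a ∈ Ioo (0:ℝ) 1 →
      μU ({x | rearr μU g a < g x} ∪ ({x | g x = rearr μU g a} ∩ Iio c))
      = ENNReal.ofReal a := by
    intro a
    by_cases ha : a ∈ Ioo (0:ℝ) 1
    · obtain ⟨c, hc⟩ := exists_c g hg a ha
      exact ⟨c, fun _ => hc⟩
    · exact ⟨0, fun h => absurd h ha⟩
  choose c hc using hex
  set E : ℝ → Set ℝ := fun a => {x | rearr μU g a < g x} ∪ ({x | g x = rearr μU g a} ∩ Iio (c a))
    with hE
  have hEm : ∀ a, MeasurableSet (E a) := fun a =>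
    (measurableSet_lt measurable_const hg).union
      ((measurableSet_eq_fun hg measurable_const).inter measurableSet_Iio)
  have hEmono : ∀ a a', a ∈ Ioo (0:ℝ) 1 → a' ∈ Ioo (0:ℝ) 1 → a ≤ a' → E a ⊆ E a' := by
    intro a a' ha ha' hle
    rcases hle.eq_or_lt with rfl | hlt
    · exact le_rfl
    rcases (rearr_antitone g hle).eq_or_lt with heq | hlt2
    · have hcc : c a ≤ c a' := by
        by_contra! h
        have : E a' ⊆ E a := by
          rintro x (hx | hx)
          · left; simpa [heq] using hx
          · right; exact ⟨by simpa [heq] using hx.1, lt_trans hx.2 h⟩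
        have h2 := measure_mono (μ := μU) this
        rw [hc a ha, hc a' ha'] at h2
        rw [ENNReal.ofReal_le_ofReal_iff ha.1.le] at h2
        linarith
      rintro x (hx | hx)
      · left; simpa [heq] using hx
      · right; exact ⟨by simpa [heq] using hx.1, lt_of_lt_of_le hx.2 hcc⟩
    · rintro x (hx | hx)
      · left; exact lt_trans hlt2 hx
      · left
        have : g x = rearr μU g a := hx.1
        simpa [this] using hlt2
  set σ : ℝ → ℝ := fun x => sInf (insert 1 {a | a ∈ Ioo (0:ℝ) 1 ∧ x ∈ E a}) with hσ
  have hbdd : ∀ x, BddBelow (insert 1 {a | a ∈ Ioo (0:ℝ) 1 ∧ x ∈ E a}) := by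
    intro x
    refine ⟨0, ?_⟩
    rintro y (rfl | hy)
    · exact zero_le_one
    · exact hy.1.1.le
  have hσlt : ∀ x t, σ x < t ↔ (1 < t ∨ ∃ a ∈ Ioo (0:ℝ) 1, x ∈ E a ∧ a < t) := by
    intro x t
    rw [hσ, csInf_lt_iff (hbdd x) ⟨1, mem_insert _ _⟩]
    simp only [mem_insert_iff, mem_ofPred_eq]
    constructor
    · rintro ⟨b, rfl | hb, hbt⟩
      · exact Or.inl hbt
      · exact Or.inr ⟨b, hb.1, hb.2, hbt⟩
    · rintro (h | ⟨a, h1, h2, h3⟩)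
      · exact ⟨1, Or.inl rfl, h⟩
      · exact ⟨a, Or.inr ⟨h1, h2⟩, h3⟩
  have hpre1 : ∀ t, 1 < t → σ ⁻¹' Iio t = univ := by
    intro t ht; ext x; simp [hσlt, ht]
  have hpre0 : ∀ t, t ≤ 0 → σ ⁻¹' Iio t = ∅ := by
    intro t ht; ext x
    simp only [mem_preimage, mem_Iio, hσlt, mem_empty_iff_false, iff_false]
    rintro (h | ⟨a, h1, h2, h3⟩)
    · linarith
    · linarith [h1.1]
  have hpre : ∀ t, 0 < t → t ≤ 1 → MeasurableSet (σ ⁻¹' Iio t) ∧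
      μU (σ ⁻¹' Iio t) = ENNReal.ofReal t := by
    intro t h0 h1
    obtain ⟨u, hu, hul, hut⟩ := exists_seq_strictMono_tendsto' h0
    have hu1 : ∀ n, u n ∈ Ioo (0:ℝ) 1 := fun n => ⟨(hul n).1, (hul n).2.trans_le h1⟩
    have e : σ ⁻¹' Iio t = ⋃ n, E (u n) := by
      ext x
      simp only [mem_preimage, mem_Iio, hσlt, mem_iUnion]
      constructor
      · rintro (h | ⟨a, ha, hx, hat⟩)
        · linarith
        · obtain ⟨n, hn⟩ := (hut.eventually_const_lt hat).exists
          exact ⟨n, hEmono a _ ha (hu1 n) hn.le hx⟩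
      · rintro ⟨n, hn⟩
        exact Or.inr ⟨u n, hu1 n, hn, (hul n).2⟩
    rw [e]
    refine ⟨MeasurableSet.iUnion fun n => hEm _, ?_⟩
    have hm : Monotone fun n => E (u n) := fun i j hij =>
      hEmono _ _ (hu1 i) (hu1 j) (hu.monotone hij)
    refine tendsto_nhds_unique (tendsto_measure_iUnion_atTop (μ := μU) hm) ?_
    have : (μU ∘ fun n => E (u n)) = fun n => ENNReal.ofReal (u n) := by
      ext n; exact hc _ (hu1 n)
    rw [this]
    exact ENNReal.tendsto_ofReal hut
  have hσm : Measurable σ := by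
    apply measurable_of_Iio
    intro t
    rcases le_or_gt t 0 with h | h
    · rw [hpre0 t h]; exact MeasurableSet.empty
    rcases le_or_gt t 1 with h' | h'
    · exact (hpre t h h').1
    · rw [hpre1 t h']; exact MeasurableSet.univ
  refine ⟨σ, ⟨hσm, ?_⟩, ?_⟩
  · haveI : IsFiniteMeasure (Measure.map σ μU) := Measure.isFiniteMeasure_map _ _
    apply Measure.ext_of_Ici
    intro t
    rw [Measure.map_apply hσm measurableSet_Ici, ← compl_Iio, preimage_compl,
      measure_compl (hσm measurableSet_Iio) (measure_ne_top _ _),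
      measure_compl measurableSet_Iio (measure_ne_top _ _)]
    congr 1
    rcases le_or_gt t 0 with h | h
    · rw [hpre0 t h]
      refine le_antisymm (by simp) ?_
      refine (measure_mono (Iio_subset_Iio h)).trans ?_
      rw [μU_Iio le_rfl zero_le_one]; simp
    rcases le_or_gt t 1 with h' | h'
    · rw [(hpre t h h').2, μU_Iio h.le h']
    · rw [hpre1 t h']
      refine le_antisymm ?_ (measure_mono (subset_univ _))
      refine le_trans ?_ (measure_mono (Iio_subset_Iio h'.le))
      rw [μU_Iio zero_le_one le_rfl]
      simpa using μU_le_one _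
  · refine Eventually.of_forall fun x => ?_
    by_contra! h
    have h1 := (lt_rearr_iff g (g x) (σ x)).1 h
    have hlt : σ x < (μU {y | g x < g y}).toReal :=
      (ENNReal.ofReal_lt_iff_lt_toReal (by
        by_contra! h0
        have := (hσlt x 0).1 h0
        rcases this with h | ⟨a, h1, h2, h3⟩
        · linarith
        · linarith [h1.1]) (measure_ne_top _ _)).1 h1
    obtain ⟨a, ha1, ha2⟩ := exists_between hlt
    have ha3 : a < 1 := by
      refine ha2.trans_le (ENNReal.toReal_le_of_le_ofReal zero_le_one ?_)
      simpa using μU_le_one _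
    rcases (hσlt x a).1 ha1 with h | ⟨b, hb, hxb, hba⟩
    · linarith
    have ha : a ∈ Ioo (0:ℝ) 1 := ⟨hb.1.trans hba, ha3⟩
    have hgx : g x < rearr μU g a := by
      rw [lt_rearr_iff]
      exact (ENNReal.ofReal_lt_iff_lt_toReal ha.1.le (measure_ne_top _ _)).2 ha2
    rcases hEmono b a hb ha hba.le hxb with h | h
    · exact absurd h (not_lt.2 hgx.le)
    · exact absurd h.1 hgx.ne

lemma lint_Iio_le (g : ℝ → ℝ≥0∞) (hg : Measurable g) (a : ℝ) (ha : 0 ≤ a) (ha1 : a ≤ 1) :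
    ∫⁻ s in Ioo (0:ℝ) a, g s ≤ ∫⁻ s in Ioo (0:ℝ) a, rearr μU g s := by
  have hrm : Measurable (rearr μU g) := (rearr_antitone g).measurable
  have hmap : Measure.map g μU = Measure.map (rearr μU g) μU := by
    haveI : IsFiniteMeasure (Measure.map g μU) := Measure.isFiniteMeasure_map _ _
    apply Measure.ext_of_Iic
    intro l
    rw [Measure.map_apply hg measurableSet_Iic, Measure.map_apply hrm measurableSet_Iic,
      ← compl_Ioi, preimage_compl, preimage_compl,
      measure_compl (hg measurableSet_Ioi) (measure_ne_top _ _),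
      measure_compl (hrm measurableSet_Ioi) (measure_ne_top _ _)]
    congr 1
    exact (rearr_equi g l).symm
  set r := rearr μU g a with hr
  have heq : ∫⁻ x, (g x - r) ∂μU = ∫⁻ x, (rearr μU g x - r) ∂μU := by
    have hφ : Measurable (fun y : ℝ≥0∞ => y - r) := measurable_id.sub_const r
    rw [← lintegral_map hφ hg, ← lintegral_map hφ hrm, hmap]
  calc ∫⁻ s in Ioo (0:ℝ) a, g s ≤ ∫⁻ s in Ioo (0:ℝ) a, (g s - r) + r :=
        lintegral_mono fun s => le_tsub_add
    _ = (∫⁻ s in Ioo (0:ℝ) a, (g s - r)) + ∫⁻ s in Ioo (0:ℝ) a, r :=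
        lintegral_add_right _ measurable_const
    _ ≤ (∫⁻ x, (g x - r) ∂μU) + ∫⁻ s in Ioo (0:ℝ) a, r := by
        refine add_le_add_left ?_ _
        exact lintegral_mono_set (Ioo_subset_Ioo_right ha1)
    _ = (∫⁻ x, (rearr μU g x - r) ∂μU) + ∫⁻ s in Ioo (0:ℝ) a, r := by rw [heq]
    _ = (∫⁻ x in Ioo (0:ℝ) a, (rearr μU g x - r)) + ∫⁻ s in Ioo (0:ℝ) a, r := by
        congr 1
        unfold μU
        rw [← lintegral_indicator measurableSet_Ioo, ← lintegral_indicator measurableSet_Ioo]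
        congr 1
        ext x
        by_cases hx : x ∈ Ioo (0:ℝ) a
        · rw [indicator_of_mem hx, indicator_of_mem (Ioo_subset_Ioo_right ha1 hx)]
        · rw [indicator_of_notMem hx]
          by_cases hx1 : x ∈ Ioo (0:ℝ) 1
          · rw [indicator_of_mem hx1]
            have : a ≤ x := by
              by_contra! h
              exact hx ⟨hx1.1, h⟩
            exact tsub_eq_zero_of_le (rearr_antitone g this)
          · rw [indicator_of_notMem hx1]
    _ = ∫⁻ x in Ioo (0:ℝ) a, ((rearr μU g x - r) + r) :=
        (lintegral_add_right _ measurable_const).symm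
    _ = ∫⁻ s in Ioo (0:ℝ) a, rearr μU g s := by
        apply setLIntegral_congr_fun measurableSet_Ioo
        intro x hx
        exact tsub_add_cancel_of_le (rearr_antitone g hx.2.le)

lemma tonelli (p q : ℝ) (hp : 0 < p) (hpq : p * q = 1) (F G : ℝ → ℝ≥0∞)
    (hF : Measurable F) (hG : Measurable G) :
    ∫⁻ t in Ioo (0:ℝ) 1, (∫⁻ s in Ioo (t ^ q) 1, F s) * G t =
      ∫⁻ s in Ioo (0:ℝ) 1, F s * ∫⁻ t in Ioo (0:ℝ) (s ^ p), G t := by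
  have hq : 0 < q := by
    by_contra! h
    nlinarith
  set K : ℝ → ℝ → ℝ≥0∞ := fun t s =>
    ({z : ℝ × ℝ | z.1 ^ q < z.2}.indicator (fun z => F z.2 * G z.1)) (t, s) with hK
  have hKm : Measurable (Function.uncurry K) := by
    change Measurable ({z : ℝ × ℝ | z.1 ^ q < z.2}.indicator (fun z => F z.2 * G z.1))
    refine Measurable.indicator (by fun_prop) ?_
    exact measurableSet_lt (by fun_prop) (by fun_prop)
  have h1 : ∫⁻ t in Ioo (0:ℝ) 1, (∫⁻ s in Ioo (t ^ q) 1, F s) * G t =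
      ∫⁻ t in Ioo (0:ℝ) 1, ∫⁻ s in Ioo (0:ℝ) 1, K t s := by
    apply setLIntegral_congr_fun measurableSet_Ioo
    intro t ht
    have h0 : 0 ≤ t ^ q := Real.rpow_nonneg ht.1.le _
    simp only
    rw [← lintegral_mul_const _ hF]
    rw [← lintegral_indicator measurableSet_Ioo, ← lintegral_indicator measurableSet_Ioo]
    congr 1
    ext s
    simp only [hK, indicator, mem_Ioo, mem_ofPred_eq]
    by_cases h : t ^ q < s
    · have : 0 < s := h0.trans_lt h
      simp [h, this]
    · simp [h]
  have h2 : ∫⁻ s in Ioo (0:ℝ) 1, F s * ∫⁻ t in Ioo (0:ℝ) (s ^ p), G t =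
      ∫⁻ s in Ioo (0:ℝ) 1, ∫⁻ t in Ioo (0:ℝ) 1, K t s := by
    apply setLIntegral_congr_fun measurableSet_Ioo
    intro s hs
    have h0 : s ^ p ≤ 1 := Real.rpow_le_one hs.1.le hs.2.le hp.le
    simp only
    rw [← lintegral_const_mul _ hG]
    rw [← lintegral_indicator measurableSet_Ioo, ← lintegral_indicator measurableSet_Ioo]
    congr 1
    ext t
    simp only [hK, indicator, mem_Ioo, mem_ofPred_eq]
    by_cases ht : 0 < t
    · have key : t ^ q < s ↔ t < s ^ p := by
        have e1 : (t ^ q) ^ p = t := by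
          rw [← Real.rpow_mul ht.le, mul_comm, hpq, Real.rpow_one]
        constructor
        · intro h
          have := Real.rpow_lt_rpow (Real.rpow_nonneg ht.le _) h hp
          rwa [e1] at this
        · intro h
          rw [← e1] at h
          exact (Real.rpow_lt_rpow_iff (Real.rpow_nonneg ht.le _) hs.1.le hp).1 h
      by_cases h : t < s ^ p
      · have : t < 1 := h.trans_le h0
        simp [ht, key, h, this]
      · simp [key, h]
    · simp [ht]
  rw [h1, h2]
  exact lintegral_lintegral_swap hKm.aemeasurable

lemma meas_T (q : ℝ) (F : ℝ → ℝ≥0∞) :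
    Measurable fun t : ℝ => ∫⁻ s in Ioo (t ^ q) 1, F s := by
  have h : Antitone fun c : ℝ => ∫⁻ s in Ioo c 1, F s := fun a b hab =>
    lintegral_mono_set (Ioo_subset_Ioo_left hab)
  exact h.measurable.comp (by fun_prop)

lemma holder (Z : RINorm μU) (f g : ℝ → ℝ≥0∞) (hf : Measurable f)
    (hZ : assocN Z g ≤ 1) : ∫⁻ t in Ioo (0:ℝ) 1, f t * g t ≤ Z.N f := by
  rcases eq_or_ne (Z.N f) 0 with h0 | h0
  · have h1 := (Z.eq_zero_iff f hf).1 h0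
    have : ∫⁻ t, f t * g t ∂μU = 0 := by
      rw [lintegral_congr_ae (g := fun _ => 0)]
      · simp
      · filter_upwards [h1] with x hx
        simp [hx]
    exact this.le.trans bot_le
  rcases eq_or_ne (Z.N f) ⊤ with ht | ht
  · rw [ht]; exact le_top
  set c : ℝ≥0 := (Z.N f).toNNReal with hc
  have hcN : (c : ℝ≥0∞) = Z.N f := ENNReal.coe_toNNReal ht
  have hc0 : c ≠ 0 := by
    intro h; rw [h] at hcN; exact h0 hcN.symm
  have hle : ∫⁻ t in Ioo (0:ℝ) 1, (((c⁻¹ : ℝ≥0) : ℝ≥0∞) * f t) * g t ≤ 1 := by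
    refine le_trans ?_ hZ
    unfold assocN
    refine le_iSup_of_le (fun t => ((c⁻¹ : ℝ≥0) : ℝ≥0∞) * f t) ?_
    refine le_iSup_of_le (hf.const_mul _) ?_
    refine le_iSup_of_le ?_ le_rfl
    rw [Z.smul_eq _ _ hf, ← hcN, ← ENNReal.coe_mul, inv_mul_cancel₀ hc0]
    simp
  have e : ∫⁻ t in Ioo (0:ℝ) 1, f t * g t =
      c * ∫⁻ t in Ioo (0:ℝ) 1, (((c⁻¹ : ℝ≥0) : ℝ≥0∞) * f t) * g t := by
    rw [← lintegral_const_mul' _ _ ENNReal.coe_ne_top]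
    congr 1
    ext t
    rw [← mul_assoc, ← mul_assoc, ← ENNReal.coe_mul, mul_inv_cancel₀ hc0]
    simp
  rw [e, ← hcN]
  calc (c : ℝ≥0∞) * _ ≤ c * 1 := by gcongr
    _ = c := mul_one _

lemma N_congr (Z : RINorm μU) (f g : ℝ → ℝ≥0∞) (hf : Measurable f) (hg : Measurable g)
    (h : f =ᵐ[μU] g) : Z.N f = Z.N g :=
  le_antisymm (Z.mono f g hf hg (h.mono fun _ hx => hx.le))
    (Z.mono g f hg hf (h.mono fun _ hx => hx.ge))

lemma Lp_meas (f : Lp ℝ 2 μU) : Measurable fun x => ‖f x‖ₑ :=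
  (Lp.stronglyMeasurable f).measurable.enorm

lemma B_convex (Z : RINorm μU) : Convex ℝ {f : Lp ℝ 2 μU | Z.N (fun x => ‖f x‖ₑ) ≤ 1} := by
  intro f hf g hg a b ha hb hab
  simp only [mem_ofPred_eq] at hf hg ⊢
  lift a to ℝ≥0 using ha
  lift b to ℝ≥0 using hb
  have hab' : a + b = 1 := by exact_mod_cast hab
  calc Z.N (fun x => ‖((a : ℝ) • f + (b : ℝ) • g : Lp ℝ 2 μU) x‖ₑ)
      ≤ Z.N (fun x => (a : ℝ≥0∞) * ‖f x‖ₑ + (b : ℝ≥0∞) * ‖g x‖ₑ) := by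
        apply Z.mono _ _ (Lp_meas _) (((Lp_meas f).const_mul _).add ((Lp_meas g).const_mul _))
        filter_upwards [Lp.coeFn_add ((a : ℝ) • f) ((b : ℝ) • g), Lp.coeFn_smul (a : ℝ) f,
          Lp.coeFn_smul (b : ℝ) g] with x h1 h2 h3
        rw [h1, Pi.add_apply, h2, h3]
        refine (enorm_add_le _ _).trans ?_
        simp [enorm_smul, enorm_mul]
    _ ≤ a * Z.N (fun x => ‖f x‖ₑ) + b * Z.N (fun x => ‖g x‖ₑ) := by
        rw [← Z.smul_eq _ _ (Lp_meas f), ← Z.smul_eq _ _ (Lp_meas g)]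
        exact Z.add_le _ _ ((Lp_meas f).const_mul _) ((Lp_meas g).const_mul _)
    _ ≤ a * 1 + b * 1 := by gcongr
    _ = 1 := by rw [mul_one, mul_one, ← ENNReal.coe_add, hab', ENNReal.coe_one]

lemma B_closed (Z : RINorm μU) : IsClosed {f : Lp ℝ 2 μU | Z.N (fun x => ‖f x‖ₑ) ≤ 1} := by
  apply IsSeqClosed.isClosed
  intro u f hu huf
  simp only [mem_ofPred_eq] at hu ⊢
  obtain ⟨ns, -, hns⟩ := (tendstoInMeasure_of_tendsto_Lp huf).exists_seq_tendsto_ae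
  set F : ℕ → ℝ → ℝ≥0∞ := fun k x => ⨅ i, ‖u (ns (k + i)) x‖ₑ with hF
  have hFm : ∀ k, Measurable (F k) := fun k => Measurable.iInf fun i => Lp_meas _
  rw [← Z.fatou F _ hFm (Lp_meas f) ?_ ?_]
  · refine iSup_le fun k => le_trans ?_ (hu (ns k))
    apply Z.mono _ _ (hFm k) (Lp_meas _)
    exact Eventually.of_forall fun x => iInf_le_of_le 0 le_rfl
  · refine Eventually.of_forall fun x k l hkl => ?_
    refine le_iInf fun i => iInf_le_of_le (l - k + i) ?_
    rw [show k + (l - k + i) = l + i by omega]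
  · filter_upwards [hns] with x hx
    have h1 : Tendsto (fun i => ‖u (ns i) x‖ₑ) atTop (𝓝 ‖f x‖ₑ) := hx.enorm
    rw [← h1.liminf_eq, Filter.liminf_eq_iSup_iInf_of_nat']
    simp only [hF]
    congr 1; ext k; congr 1; ext i; rw [add_comm]

lemma LL_core (Z : RINorm μU) (h : ℝ → ℝ≥0∞) (hh : Measurable h) (k : ℕ)
    (hk : ∀ x, h x ≤ k) (hN : 1 < Z.N h) :
    ∃ g, Measurable g ∧ assocN Z g ≤ 1 ∧ 1 < ∫⁻ t in Ioo (0:ℝ) 1, h t * g t := by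
  have hmem : ∀ (w : ℝ → ℝ≥0∞) (s : ℝ → ℝ) (j : ℕ), Measurable w → Measurable s →
      (∀ x, w x ≤ j) → (∀ x, |s x| ≤ 1) → MemLp (fun x => (w x).toReal * s x) 2 μU := by
    intro w s j hw hs hj hs1
    refine MemLp.of_bound (hw.ennreal_toReal.mul hs).aestronglyMeasurable j ?_
    refine Eventually.of_forall fun x => ?_
    rw [norm_mul, Real.norm_eq_abs, Real.norm_eq_abs, abs_of_nonneg ENNReal.toReal_nonneg]
    have : (w x).toReal ≤ j := by
      have := ENNReal.toReal_mono (ENNReal.natCast_ne_top j) (hj x)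
      simpa using this
    calc (w x).toReal * |s x| ≤ j * 1 := by gcongr; exact hs1 x
      _ = j := mul_one _
  have hH := hmem h (fun _ => 1) k hh measurable_const hk (by simp)
  set H := hH.toLp _ with hHdef
  have hHn : H ∉ {f : Lp ℝ 2 μU | Z.N (fun x => ‖f x‖ₑ) ≤ 1} := by
    simp only [mem_ofPred_eq, not_le]
    rw [N_congr Z _ h (Lp_meas H) hh]
    · exact hN
    · filter_upwards [hH.coeFn_toLp] with x hx
      rw [hx, mul_one, Real.enorm_eq_ofReal ENNReal.toReal_nonneg, ENNReal.ofReal_toReal]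
      exact ne_top_of_le_ne_top (ENNReal.natCast_ne_top k) (hk x)
  obtain ⟨φ, u, hφB, hφH⟩ := geometric_hahn_banach_closed_point (B_convex Z) (B_closed Z) hHn
  set v := (InnerProductSpace.toDual ℝ (Lp ℝ 2 μU)).symm φ with hv
  have hφ : ∀ f : Lp ℝ 2 μU, φ f = ∫ x, f x * v x ∂μU := by
    intro f
    rw [← InnerProductSpace.toDual_symm_apply, L2.inner_def]
    rfl
  have hu0 : 0 < u := by
    have := hφB 0 (by
      simp only [mem_ofPred_eq]
      rw [(Z.eq_zero_iff _ (Lp_meas 0)).2]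
      · exact zero_le_one
      · filter_upwards [Lp.coeFn_zero ℝ 2 μU] with x hx
        rw [hx]; simp)
    simpa using this
  have hvm : Measurable (fun x => v x) := (Lp.stronglyMeasurable v).measurable
  have hou0 : ENNReal.ofReal u ≠ 0 := by simpa using hu0
  refine ⟨fun x => (ENNReal.ofReal u)⁻¹ * ‖v x‖ₑ, (Lp_meas v).const_mul _, ?_, ?_⟩
  · unfold assocN
    refine iSup_le fun f => iSup_le fun hf => iSup_le fun hfN => ?_
    have key : ∀ j : ℕ, ∫⁻ x, min (f x) j * ‖v x‖ₑ ∂μU ≤ ENNReal.ofReal u := by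
      intro j
      have hsm : Measurable (fun x => if 0 ≤ v x then (1:ℝ) else -1) :=
        Measurable.ite (measurableSet_le measurable_const hvm) measurable_const measurable_const
      have hF := hmem (fun x => min (f x) j) (fun x => if 0 ≤ v x then (1:ℝ) else -1) j
        (hf.min measurable_const) hsm (fun x => min_le_right _ _)
        (fun x => by split_ifs <;> simp)
      have hFB : hF.toLp _ ∈ {f : Lp ℝ 2 μU | Z.N (fun x => ‖f x‖ₑ) ≤ 1} := by
        simp only [mem_ofPred_eq]
        refine le_trans (Z.mono _ f (Lp_meas _) hf ?_) hfN
        filter_upwards [hF.coeFn_toLp] with x hx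
        rw [hx, enorm_mul, Real.enorm_eq_ofReal ENNReal.toReal_nonneg]
        have : ‖(if 0 ≤ v x then (1:ℝ) else -1)‖ₑ = 1 := by split_ifs <;> simp
        rw [this, mul_one]
        exact ENNReal.ofReal_toReal_le.trans (min_le_left _ _)
      have h1 := (hφB _ hFB).le
      rw [hφ] at h1
      have hint : Integrable (fun x => (hF.toLp _ : Lp ℝ 2 μU) x * v x) μU :=
        L2.integrable_inner (𝕜 := ℝ) v (hF.toLp _)
      have hval : ∀ᵐ x ∂μU, (hF.toLp _ : Lp ℝ 2 μU) x * v x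
          = (min (f x) (j : ℝ≥0∞)).toReal * |v x| := by
        filter_upwards [hF.coeFn_toLp] with x hx
        rw [hx]
        split_ifs with h
        · rw [abs_of_nonneg h]; ring
        · rw [abs_of_neg (not_le.1 h)]; ring
      have h2 := ENNReal.ofReal_le_ofReal h1
      rw [ofReal_integral_eq_lintegral_ofReal hint ?_] at h2
      · refine le_trans (le_of_eq ?_) h2
        apply lintegral_congr_ae
        filter_upwards [hval] with x hx
        rw [hx, ENNReal.ofReal_mul ENNReal.toReal_nonneg, ENNReal.ofReal_toReal,
          Real.enorm_eq_ofReal_abs]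
        exact ne_top_of_le_ne_top (ENNReal.natCast_ne_top j) (min_le_right _ _)
      · filter_upwards [hval] with x hx
        rw [hx]; simp only [Pi.zero_apply]; positivity
    have hsup : ∫⁻ x, f x * ‖v x‖ₑ ∂μU ≤ ENNReal.ofReal u := by
      have e : ∀ x, f x * ‖v x‖ₑ = ⨆ j : ℕ, min (f x) j * ‖v x‖ₑ := by
        intro x
        rw [← ENNReal.iSup_mul]
        congr 1
        rw [← inf_iSup_eq, ENNReal.iSup_natCast, inf_top_eq]
      simp_rw [e]
      rw [lintegral_iSup]
      · exact iSup_le key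
      · intro j; exact (hf.min measurable_const).mul (Lp_meas v)
      · intro i j hij x
        simp only
        gcongr
    have e2 : ∀ x, f x * ((ENNReal.ofReal u)⁻¹ * ‖v x‖ₑ) =
        (ENNReal.ofReal u)⁻¹ * (f x * ‖v x‖ₑ) := fun x => by ring
    simp_rw [e2]
    rw [lintegral_const_mul' _ _ (ENNReal.inv_ne_top.2 hou0)]
    calc _ ≤ (ENNReal.ofReal u)⁻¹ * ENNReal.ofReal u := by gcongr; exact hsup
      _ = 1 := ENNReal.inv_mul_cancel hou0 ENNReal.ofReal_ne_top
  · have e2 : ∀ x, h x * ((ENNReal.ofReal u)⁻¹ * ‖v x‖ₑ) =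
        (ENNReal.ofReal u)⁻¹ * (h x * ‖v x‖ₑ) := fun x => by ring
    simp_rw [e2]
    rw [lintegral_const_mul' _ _ (ENNReal.inv_ne_top.2 hou0)]
    have h3 : ENNReal.ofReal u < ∫⁻ x, h x * ‖v x‖ₑ ∂μU := by
      calc ENNReal.ofReal u < ENNReal.ofReal (φ H) :=
            (ENNReal.ofReal_lt_ofReal_iff (hu0.trans hφH)).2 hφH
        _ ≤ ‖φ H‖ₑ := by
            rw [Real.enorm_eq_ofReal_abs]; exact ENNReal.ofReal_le_ofReal (le_abs_self _)
        _ ≤ ∫⁻ x, ‖H x * v x‖ₑ ∂μU := by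
            rw [hφ]; exact enorm_integral_le_lintegral_enorm _
        _ = ∫⁻ x, h x * ‖v x‖ₑ ∂μU := by
            apply lintegral_congr_ae
            filter_upwards [hH.coeFn_toLp] with x hx
            rw [enorm_mul, hx, mul_one, Real.enorm_eq_ofReal ENNReal.toReal_nonneg,
              ENNReal.ofReal_toReal]
            exact ne_top_of_le_ne_top (ENNReal.natCast_ne_top k) (hk x)
    calc (1 : ℝ≥0∞) = (ENNReal.ofReal u)⁻¹ * ENNReal.ofReal u :=
          (ENNReal.inv_mul_cancel hou0 ENNReal.ofReal_ne_top).symm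
      _ < _ := by
          exact ENNReal.mul_lt_mul_right (ENNReal.inv_ne_zero.2 ENNReal.ofReal_ne_top)
            (ENNReal.inv_ne_top.2 hou0) h3

lemma LL (Z : RINorm μU) (h : ℝ → ℝ≥0∞) (hh : Measurable h) (c : ℝ≥0∞) (hc : c < Z.N h) :
    ∃ g, Measurable g ∧ assocN Z g ≤ 1 ∧ c < ∫⁻ t in Ioo (0:ℝ) 1, h t * g t := by
  obtain ⟨d, hcd, hdN⟩ := ENNReal.lt_iff_exists_nnreal_btwn.1 hc
  have hd0 : d ≠ 0 := by
    rintro rfl; simp at hcd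
  set w : ℝ → ℝ≥0∞ := fun x => ((d⁻¹ : ℝ≥0) : ℝ≥0∞) * h x with hw
  have hwm : Measurable w := hh.const_mul _
  have hwN : 1 < Z.N w := by
    rw [hw, Z.smul_eq _ _ hh, ENNReal.coe_inv hd0]
    calc (1 : ℝ≥0∞) = (d : ℝ≥0∞)⁻¹ * d :=
          (ENNReal.inv_mul_cancel (by simpa using hd0) ENNReal.coe_ne_top).symm
      _ < _ := ENNReal.mul_lt_mul_right (by simp) (by simpa using hd0) hdN
  have hfat := Z.fatou (fun (j : ℕ) x => min (w x) j) w
    (fun j => hwm.min measurable_const) hwm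
    (Eventually.of_forall fun x i j hij => by simp only; gcongr)
    (Eventually.of_forall fun x => by
      rw [← inf_iSup_eq, ENNReal.iSup_natCast, inf_top_eq])
  rw [← hfat, lt_iSup_iff] at hwN
  obtain ⟨j, hj⟩ := hwN
  obtain ⟨g, hg, hgZ, hlt⟩ := LL_core Z _ (hwm.min measurable_const) j
    (fun x => min_le_right _ _) hj
  refine ⟨g, hg, hgZ, hcd.trans ?_⟩
  have h1 : 1 < ∫⁻ t in Ioo (0:ℝ) 1, w t * g t :=
    hlt.trans_le (lintegral_mono fun t => by gcongr; exact min_le_left _ _)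
  have e : ∫⁻ t in Ioo (0:ℝ) 1, h t * g t = d * ∫⁻ t in Ioo (0:ℝ) 1, w t * g t := by
    rw [← lintegral_const_mul' _ _ ENNReal.coe_ne_top]
    congr 1
    ext t
    rw [hw, ← mul_assoc, ← mul_assoc, ← ENNReal.coe_mul, mul_inv_cancel₀ hd0]
    simp
  rw [e]
  calc (d : ℝ≥0∞) = d * 1 := (mul_one _).symm
    _ < _ := ENNReal.mul_lt_mul_right (by simpa using hd0) ENNReal.coe_ne_top h1

/-- the duality identity behind the description of the optimal target space
in the weighted Sobolev embedding on balls. -/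
theorem duality_identity_optimal_target (m n : ℕ) (hm : 1 ≤ m) (hn : 2 ≤ n)
    (α : ℝ) (hα : 0 ≤ α) (X Z : RINorm μU) :
    (⨆ (f : ℝ → ℝ≥0∞) (_ : Measurable f) (_ : X.N f ≤ 1),
        Z.N fun t => ∫⁻ s in Set.Ioo (t ^ ((n : ℝ) / ((n : ℝ) + α))) 1,
          f s * ENNReal.ofReal (s ^ ((m : ℝ) / (n : ℝ) - 1)))
      =
      ⨆ (g : ℝ → ℝ≥0∞) (_ : Measurable g) (_ : assocN Z g ≤ 1),
        assocN X fun t => ENNReal.ofReal (t ^ (((m : ℝ) + α) / (n : ℝ))) *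
          ((ENNReal.ofReal (t ^ (((n : ℝ) + α) / (n : ℝ))))⁻¹ *
            ∫⁻ s in Set.Ioo (0 : ℝ) (t ^ (((n : ℝ) + α) / (n : ℝ))), rearr μU g s) := by
  have hn0 : (0:ℝ) < n := by
    have : 0 < n := by omega
    exact_mod_cast this
  set p : ℝ := ((n : ℝ) + α) / (n : ℝ) with hp
  set q : ℝ := (n : ℝ) / ((n : ℝ) + α) with hq
  have hp0 : 0 < p := by positivity
  have hpq : p * q = 1 := by
    rw [hp, hq]; field_simp
  -- the basic identity
  have key : ∀ f g : ℝ → ℝ≥0∞, Measurable f → Measurable g →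
      ∫⁻ t in Ioo (0:ℝ) 1, (∫⁻ s in Ioo (t ^ q) 1,
          f s * ENNReal.ofReal (s ^ ((m : ℝ) / (n : ℝ) - 1))) * g t =
      ∫⁻ t in Ioo (0:ℝ) 1, f t * (ENNReal.ofReal (t ^ (((m : ℝ) + α) / (n : ℝ))) *
          ((ENNReal.ofReal (t ^ p))⁻¹ * ∫⁻ s in Ioo (0 : ℝ) (t ^ p), g s)) := by
    intro f g hf hg
    rw [tonelli p q hp0 hpq (fun s => f s * ENNReal.ofReal (s ^ ((m : ℝ) / (n : ℝ) - 1))) g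
      (hf.mul (by fun_prop)) hg]
    apply setLIntegral_congr_fun measurableSet_Ioo
    intro t ht
    have ht0 : 0 < t := ht.1
    simp only
    rw [mul_assoc, ← mul_assoc (ENNReal.ofReal (t ^ (((m : ℝ) + α) / (n : ℝ)))),
      ← ENNReal.ofReal_inv_of_pos (Real.rpow_pos_of_pos ht0 _),
      ← ENNReal.ofReal_mul (Real.rpow_nonneg ht0.le _), ← Real.rpow_neg ht0.le,
      ← Real.rpow_add ht0]
    have : ((m : ℝ) + α) / (n : ℝ) + -p = (m : ℝ) / (n : ℝ) - 1 := by
      rw [hp]; field_simp; ring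
    rw [this]
  apply le_antisymm
  · refine iSup_le fun f => iSup_le fun hf => iSup_le fun hfX => ?_
    refine le_of_forall_lt fun c hc => ?_
    obtain ⟨g, hg, hgZ, hlt⟩ := LL Z _ (meas_T q _) c hc
    refine hlt.trans_le ?_
    refine le_iSup_of_le g (le_iSup_of_le hg (le_iSup_of_le hgZ ?_))
    unfold assocN
    refine le_iSup_of_le f (le_iSup_of_le hf (le_iSup_of_le hfX ?_))
    rw [key f g hf hg]
    refine setLIntegral_mono' measurableSet_Ioo fun t ht => ?_
    refine mul_le_mul_right (mul_le_mul_right (mul_le_mul_right ?_ _) _) _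
    exact lint_Iio_le g hg _ (Real.rpow_nonneg ht.1.le _)
      (Real.rpow_le_one ht.1.le ht.2.le hp0.le)
  · refine iSup_le fun g => iSup_le fun hg => iSup_le fun hgZ => ?_
    rw [assocN]
    refine iSup_le fun f => iSup_le fun hf => iSup_le fun hfX => ?_
    refine le_iSup_of_le f (le_iSup_of_le hf (le_iSup_of_le hfX ?_))
    have hrm : Measurable (rearr μU g) := (rearr_antitone g).measurable
    rw [← key f _ hf hrm]
    set T : ℝ → ℝ≥0∞ := fun t => ∫⁻ s in Ioo (t ^ q) 1,
          f s * ENNReal.ofReal (s ^ ((m : ℝ) / (n : ℝ) - 1)) with hT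
    have hTm : Measurable T := meas_T q _
    obtain ⟨σ, hσ, hσg⟩ := exists_sigma g hg
    calc ∫⁻ t in Ioo (0:ℝ) 1, T t * rearr μU g t
        = ∫⁻ t, T t * rearr μU g t ∂μU := rfl
      _ = ∫⁻ t, T (σ t) * rearr μU g (σ t) ∂μU :=
          (hσ.lintegral_comp (hTm.mul hrm)).symm
      _ ≤ ∫⁻ t, T (σ t) * g t ∂μU := by
          apply lintegral_mono_ae
          filter_upwards [hσg] with x hx
          gcongr
      _ ≤ Z.N (fun t => T (σ t)) := holder Z _ g (hTm.comp hσ.measurable) hgZ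
      _ = Z.N T := by
          apply Z.rearr_invariant _ _ (hTm.comp hσ.measurable) hTm
          intro l
          exact hσ.measure_preimage (measurableSet_lt measurable_const hTm).nullMeasurableSet

end
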